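/- If g·(t₀/ε_k) → h₀ in (H,d) as k → ∞, then h₀ ∈ O(g) and lim_{k→∞} dist(y_{ε_k}(t₀/ε_k), A_{(h₀, x₀(t₀))}) = 0. -/

import Mathlib

open Filter Topology Metric Set

noncomputable section

/-- The time-translate h·s of a map, as a continuous map. -/
def timeTranslate {n m : ℕ} (s : ℝ)
    (h : C(EuclideanSpace ℝ (Fin n) × EuclideanSpace ℝ (Fin m) × ℝ,
      EuclideanSpace ℝ (Fin m))) :
    C(EuclideanSpace ℝ (Fin n) × EuclideanSpace ℝ (Fin m) × ℝ,
      EuclideanSpace ℝ (Fin m)) :=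
  ⟨fun p => h (p.1, p.2.1, p.2.2 + s), h.continuous.comp (by fun_prop)⟩

/-- Admissibility: bounded and uniformly continuous on K × ℝ for every compact K. -/
def IsAdmissibleMap {n m : ℕ}
    (g : C(EuclideanSpace ℝ (Fin n) × EuclideanSpace ℝ (Fin m) × ℝ,
      EuclideanSpace ℝ (Fin m))) : Prop :=
  ∀ K : Set (EuclideanSpace ℝ (Fin n) × EuclideanSpace ℝ (Fin m)), IsCompact K →
    (∃ C : ℝ, ∀ x y (τ : ℝ), (x, y) ∈ K → ‖g (x, y, τ)‖ ≤ C) ∧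
    (∀ ε > (0:ℝ), ∃ δ > (0:ℝ), ∀ x y (τ : ℝ) x' y' (τ' : ℝ), (x, y) ∈ K → (x', y') ∈ K →
      dist ((x, y, τ) : EuclideanSpace ℝ (Fin n) × EuclideanSpace ℝ (Fin m) × ℝ)
        (x', y', τ') < δ → dist (g (x, y, τ)) (g (x', y', τ')) < ε)

/-- Uniform Lipschitz continuity in y on compact sets. -/
def IsLipschitzInY {n m : ℕ}
    (g : C(EuclideanSpace ℝ (Fin n) × EuclideanSpace ℝ (Fin m) × ℝ,
      EuclideanSpace ℝ (Fin m))) : Prop :=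
  ∀ K₀ : Set (EuclideanSpace ℝ (Fin n)), IsCompact K₀ →
    ∀ K : Set (EuclideanSpace ℝ (Fin m)), IsCompact K →
      ∃ L > (0:ℝ), ∀ x ∈ K₀, ∀ y₁ ∈ K, ∀ y₂ ∈ K, ∀ τ : ℝ,
        ‖g (x, y₁, τ) - g (x, y₂, τ)‖ ≤ L * ‖y₁ - y₂‖

/-- The compact tubular neighbourhood K₀ of the slow limit x₀. -/
def slowTube {n : ℕ} (x0 : ℝ → EuclideanSpace ℝ (Fin n)) (t₀ r : ℝ) :
    Set (EuclideanSpace ℝ (Fin n)) :=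
  {z | ∃ t ∈ Set.Icc (0:ℝ) t₀, ∃ v : EuclideanSpace ℝ (Fin n), ‖v‖ ≤ r ∧ z = x0 t + v}

/-- The fiber A_{(h,x)}: initial values of bounded entire solutions of y' = h(x,y,τ). -/
def attrFiber {n m : ℕ} {H : Type*}
    (ev : H → C(EuclideanSpace ℝ (Fin n) × EuclideanSpace ℝ (Fin m) × ℝ,
      EuclideanSpace ℝ (Fin m)))
    (h : H) (x : EuclideanSpace ℝ (Fin n)) : Set (EuclideanSpace ℝ (Fin m)) :=
  {z | ∃ y : ℝ → EuclideanSpace ℝ (Fin m), y 0 = z ∧ (∃ C, ∀ τ : ℝ, ‖y τ‖ ≤ C) ∧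
    ∀ τ : ℝ, HasDerivAt y (ev h (x, y τ, τ)) τ}

/-- The parametrically inflated fiber A_{(h,x)}[δ] over the base H × K₀. -/
def inflFiber {n m : ℕ} {H : Type*} [MetricSpace H]
    (ev : H → C(EuclideanSpace ℝ (Fin n) × EuclideanSpace ℝ (Fin m) × ℝ,
      EuclideanSpace ℝ (Fin m)))
    (K₀ : Set (EuclideanSpace ℝ (Fin n)))
    (h : H) (x : EuclideanSpace ℝ (Fin n)) (δ : ℝ) : Set (EuclideanSpace ℝ (Fin m)) :=
  ⋃ p ∈ {p : H × EuclideanSpace ℝ (Fin n) |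
    p.2 ∈ K₀ ∧ max (dist h p.1) (dist x p.2) ≤ δ}, attrFiber ev p.1 p.2

/-- The inflated fiber Aˣ_h[δ] (inflation only in the hull variable). -/
def inflFiberH {n m : ℕ} {H : Type*} [MetricSpace H]
    (ev : H → C(EuclideanSpace ℝ (Fin n) × EuclideanSpace ℝ (Fin m) × ℝ,
      EuclideanSpace ℝ (Fin m)))
    (h : H) (x : EuclideanSpace ℝ (Fin n)) (δ : ℝ) : Set (EuclideanSpace ℝ (Fin m)) :=
  ⋃ h' ∈ {h' : H | dist h' h ≤ δ}, attrFiber ev h' x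

/-- The omega-limit set O(g₀) of g₀ for the flow σf. -/
def omegaSet {H : Type*} [TopologicalSpace H] (σf : ℝ → H → H) (g0 : H) : Set H :=
  ⋂ s ∈ Set.Ici (0:ℝ), closure {h : H | ∃ τ ≥ s, h = σf τ g0}

/-- The parametrically inflated fiber over the base O(g) × K₀. -/
def inflFiberO {n m : ℕ} {H : Type*} [MetricSpace H]
    (ev : H → C(EuclideanSpace ℝ (Fin n) × EuclideanSpace ℝ (Fin m) × ℝ,
      EuclideanSpace ℝ (Fin m)))
    (σf : ℝ → H → H) (g0 : H)
    (K₀ : Set (EuclideanSpace ℝ (Fin n)))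
    (h : H) (x : EuclideanSpace ℝ (Fin n)) (δ : ℝ) : Set (EuclideanSpace ℝ (Fin m)) :=
  ⋃ p ∈ {p : H × EuclideanSpace ℝ (Fin n) |
    p.1 ∈ omegaSet σf g0 ∧ p.2 ∈ K₀ ∧ max (dist h p.1) (dist x p.2) ≤ δ},
      attrFiber ev p.1 p.2

end

open scoped NNReal in
/-- Grönwall with a bootstrap: an approximate solution `w` starting near a solution `u` stays near
it, where the Lipschitz and approximation bounds are only known on a ball containing a
`1`-neighbourhood of the trajectory of `u`. -/
theorem dist_lt_of_approx_solution {Y : Type*} [NormedAddCommGroup Y] [NormedSpace ℝ Y]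
    {F : ℝ → Y → Y} {u w w' : ℝ → Y} {R η δ s T : ℝ} {L : ℝ≥0}
    (hu : ∀ t ∈ Icc 0 T, HasDerivAt u (F t (u t)) t) (huR : ∀ t ∈ Icc 0 T, ‖u t‖ ≤ R)
    (hF : ∀ t ∈ Icc 0 T, LipschitzOnWith L (F t) (closedBall 0 (R + 1)))
    (hη : η ≤ 1) (hsT : s ≤ T) (hw : ∀ t ∈ Icc 0 s, HasDerivAt w (w' t) t)
    (happrox : ∀ t ∈ Icc 0 s, ‖w t‖ ≤ R + 1 → dist (w' t) (F t (w t)) ≤ δ)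
    (h0 : dist (w 0) (u 0) ≤ δ) (hδ : gronwallBound δ L δ T < η) :
    ∀ t ∈ Icc 0 s, dist (w t) (u t) < η := by
  by_contra! hcon
  have hcw : ContinuousOn w (Icc 0 s) := fun t ht => (hw t ht).continuousAt.continuousWithinAt
  have hcu : ContinuousOn u (Icc 0 s) := fun t ht =>
    (hu t ⟨ht.1, ht.2.trans hsT⟩).continuousAt.continuousWithinAt
  have hcompact : IsCompact (Icc 0 s ∩ (fun t => dist (w t) (u t)) ⁻¹' Ici η) :=
    isCompact_Icc.of_isClosed_subset
      ((continuous_dist.comp_continuousOn (hcw.prodMk hcu)).preimage_isClosed_of_isClosed isClosed_Icc isClosed_Ici) inter_subset_left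
  obtain ⟨t₁, ⟨ht₁, hd⟩, hleast⟩ := hcompact.exists_isLeast (by
    obtain ⟨t, ht, h⟩ := hcon
    exact ⟨t, ht, h⟩)
  have hbefore : ∀ t ∈ Ico 0 t₁, dist (w t) (u t) < η := by
    intro t ht
    by_contra! h
    exact absurd (hleast ⟨⟨ht.1, ht.2.le.trans ht₁.2⟩, h⟩) (not_le.2 ht.2)
  have hsub : ∀ t ∈ Icc 0 t₁, t ∈ Icc 0 s := fun t ht => ⟨ht.1, ht.2.trans ht₁.2⟩
  have hsubT : ∀ t ∈ Icc 0 s, t ∈ Icc 0 T := fun t ht => ⟨ht.1, ht.2.trans hsT⟩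
  have hwR : ∀ t ∈ Ico 0 t₁, ‖w t‖ ≤ R + 1 := by
    intro t ht
    have h1 := hbefore t ht
    have h2 := huR t (hsubT t (hsub t (Ico_subset_Icc_self ht)))
    have h3 := norm_le_norm_add_norm_sub' (w t) (u t)
    rw [dist_eq_norm] at h1
    linarith
  have key := dist_le_of_approx_trajectories_ODE_of_mem (K := L) (v := F) (f := w) (g := u)
    (f' := w') (g' := fun t => F t (u t)) (a := 0) (b := t₁) (εf := δ) (εg := 0) (δ := δ)
    (s := fun _ => closedBall 0 (R + 1))
    (fun t ht => hF t (hsubT t (hsub t (Ico_subset_Icc_self ht))))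
    (hcw.mono hsub)
    (fun t ht => (hw t (hsub t (Ico_subset_Icc_self ht))).hasDerivWithinAt)
    (fun t ht => happrox t (hsub t (Ico_subset_Icc_self ht)) (hwR t ht))
    (fun t ht => by simpa using hwR t ht)
    (hcu.mono hsub)
    (fun t ht => (hu t (hsubT t (hsub t (Ico_subset_Icc_self ht)))).hasDerivWithinAt)
    (fun t ht => by simp)
    (fun t ht => by
      have := huR t (hsubT t (hsub t (Ico_subset_Icc_self ht)))
      simp only [mem_closedBall, dist_zero_right]
      linarith)
    h0 t₁ ⟨ht₁.1, le_rfl⟩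
  have hδ0 : 0 ≤ δ := dist_nonneg.trans h0
  have hmono := gronwallBound_mono hδ0 hδ0 L.2 (ht₁.2.trans hsT)
  simp only [sub_zero, add_zero] at key
  have hd' : η ≤ dist (w t₁) (u t₁) := hd
  exact absurd (key.trans hmono) (not_le.2 (hδ.trans_le hd'))

/-- The Grönwall bound tends to zero with its data. -/
theorem exists_pos_gronwallBound_lt (L T : ℝ) {η : ℝ} (hη : 0 < η) :
    ∃ δ > 0, gronwallBound δ L δ T < η := by
  have hcont : Continuous fun δ => gronwallBound δ L δ T := by
    unfold gronwallBound
    split_ifs <;> fun_prop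
  have hlim : Tendsto (fun δ => gronwallBound δ L δ T) (𝓝[>] 0) (𝓝 0) := by
    have := hcont.tendsto 0
    rw [gronwallBound_ε0_δ0] at this
    exact this.mono_left nhdsWithin_le_nhds
  obtain ⟨δ, h1, h2⟩ := ((hlim.eventually_lt_const hη).and self_mem_nhdsWithin).exists
  exact ⟨δ, h2, h1⟩

section ParametrizedField

open scoped NNReal

/-- Continuous dependence: solutions driven by a nearby base point and a nearby (possibly moving)
parameter, with nearby initial value, track a given solution on a bounded time interval. -/
theorem exists_radius_dist_lt {H X Y : Type*} [PseudoMetricSpace H] [PseudoMetricSpace X]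
    [NormedAddCommGroup Y] [NormedSpace ℝ Y] [ProperSpace Y] {V : H → X → ℝ → Y → Y}
    (hV : Continuous fun p : (H × X) × (ℝ × Y) => V p.1.1 p.1.2 p.2.1 p.2.2)
    (hL : ∀ h x R, ∃ L : ℝ≥0, ∀ t, LipschitzOnWith L (V h x t) (closedBall 0 R))
    {h : H} {x : X} {T η : ℝ} {u : ℝ → Y} (hη : 0 < η)
    (hu : ∀ t ∈ Icc 0 T, HasDerivAt u (V h x t (u t)) t) :
    ∃ ρ > 0, ∀ h' : H, dist h' h < ρ → ∀ s ≤ T, ∀ (ξ : ℝ → X) (w : ℝ → Y),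
      (∀ t ∈ Icc 0 s, dist (ξ t) x < ρ) →
      (∀ t ∈ Icc 0 s, HasDerivAt w (V h' (ξ t) t (w t)) t) → dist (w 0) (u 0) < ρ →
      ∀ t ∈ Icc 0 s, dist (w t) (u t) < η := by
  have hcu : ContinuousOn u (Icc 0 T) := fun t ht => (hu t ht).continuousAt.continuousWithinAt
  obtain ⟨R, hR⟩ := isCompact_Icc.exists_bound_of_continuousOn hcu
  obtain ⟨L, hLip⟩ := hL h x (R + 1)
  obtain ⟨δ, hδ, hgr⟩ := exists_pos_gronwallBound_lt L T (lt_min hη one_pos)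
  let Φ : C(H × X, C(ℝ × Y, Y)) := ContinuousMap.curry ⟨_, hV⟩
  have hΦ := ContinuousMap.tendsto_iff_forall_isCompact_tendstoUniformlyOn.1
    (Φ.continuous.tendsto (h, x)) (Icc 0 T ×ˢ closedBall 0 (R + 1))
    (isCompact_Icc.prod (isCompact_closedBall _ _))
  obtain ⟨ρ, hρ, hball⟩ :=
    Metric.eventually_nhds_iff.1 (Metric.tendstoUniformlyOn_iff.1 hΦ δ hδ)
  refine ⟨min ρ δ, lt_min hρ hδ, fun h' hh' s hs ξ w hξ hw h0 t ht => ?_⟩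
  refine lt_of_lt_of_le (dist_lt_of_approx_solution hu hR (fun t _ => hLip t) (min_le_right _ _)
    hs hw (fun r hr hwr => ?_) (h0.le.trans (min_le_right _ _)) hgr t ht) (min_le_left _ _)
  have hd : dist (h', ξ r) (h, x) < ρ :=
    max_lt (hh'.trans_le (min_le_left _ _)) ((hξ r hr).trans_le (min_le_left _ _))
  have := hball hd (r, w r) ⟨⟨hr.1, hr.2.trans hs⟩, by simpa using hwr⟩
  rw [dist_comm]
  exact this.le

/-- Uniform bounds, over a compact set of data, for solutions with a slowly moving parameter. -/
theorem exists_uniform_bound {H X Y : Type*} [PseudoMetricSpace H] [PseudoMetricSpace X]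
    [NormedAddCommGroup Y] [NormedSpace ℝ Y] [ProperSpace Y] {V : H → X → ℝ → Y → Y}
    (hV : Continuous fun p : (H × X) × (ℝ × Y) => V p.1.1 p.1.2 p.2.1 p.2.2)
    (hL : ∀ h x R, ∃ L : ℝ≥0, ∀ t, LipschitzOnWith L (V h x t) (closedBall 0 R))
    {K : Set (H × X × Y)} (hK : IsCompact K) {T c : ℝ}
    (hsol : ∀ p ∈ K, ∃ u : ℝ → Y, u 0 = p.2.2 ∧
      (∀ t ∈ Icc 0 T, HasDerivAt u (V p.1 p.2.1 t (u t)) t) ∧ ‖u T‖ ≤ c) :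
    ∃ ρ > 0, ∃ M, ∀ p ∈ K, ∀ s ≤ T, ∀ (ξ : ℝ → X) (w : ℝ → Y),
      (∀ t ∈ Icc 0 s, dist (ξ t) p.2.1 < ρ) → w 0 = p.2.2 →
      (∀ t ∈ Icc 0 s, HasDerivAt w (V p.1 (ξ t) t (w t)) t) →
      ∀ t ∈ Icc 0 s, ‖w t‖ ≤ M ∧ (t = T → ‖w t‖ ≤ c + 1) := by
  have key : ∀ p ∈ K, ∃ ρ > 0, ∃ M, ∀ q : H × X × Y, dist q p < ρ → ∀ s ≤ T,
      ∀ (ξ : ℝ → X) (w : ℝ → Y), (∀ t ∈ Icc 0 s, dist (ξ t) q.2.1 < ρ) → w 0 = q.2.2 →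
      (∀ t ∈ Icc 0 s, HasDerivAt w (V q.1 (ξ t) t (w t)) t) →
      ∀ t ∈ Icc 0 s, ‖w t‖ ≤ M ∧ (t = T → ‖w t‖ ≤ c + 1) := by
    intro p hp
    obtain ⟨u, hu0, hu, huT⟩ := hsol p hp
    obtain ⟨R, hR⟩ := isCompact_Icc.exists_bound_of_continuousOn
      (fun t ht => (hu t ht).continuousAt.continuousWithinAt : ContinuousOn u (Icc 0 T))
    obtain ⟨ρ, hρ, hnear⟩ := exists_radius_dist_lt hV hL one_pos hu
    refine ⟨ρ / 2, half_pos hρ, R + 1, fun q hq s hs ξ w hξ hw0 hw t ht => ?_⟩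
    have hq1 : dist q.1 p.1 < ρ / 2 := (le_max_left _ _).trans_lt hq
    have hq2 : dist q.2.1 p.2.1 < ρ / 2 :=
      ((le_max_left _ _).trans (le_max_right _ _)).trans_lt hq
    have hq3 : dist q.2.2 p.2.2 < ρ / 2 :=
      ((le_max_right _ _).trans (le_max_right _ _)).trans_lt hq
    have hd := hnear q.1 (by linarith) s hs ξ w
      (fun t ht => by linarith [hξ t ht, dist_triangle (ξ t) q.2.1 p.2.1]) hw
      (by rw [hw0, hu0]; linarith) t ht
    have hn := norm_le_norm_add_norm_sub' (w t) (u t)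
    rw [dist_eq_norm] at hd
    refine ⟨by linarith [hR t ⟨ht.1, ht.2.trans hs⟩], fun h => ?_⟩
    rw [h] at hd hn ⊢
    linarith
  refine hK.induction_on (p := fun S => ∃ ρ > 0, ∃ M, ∀ p ∈ S, ∀ s ≤ T, ∀ (ξ : ℝ → X) (w : ℝ → Y),
      (∀ t ∈ Icc 0 s, dist (ξ t) p.2.1 < ρ) → w 0 = p.2.2 →
      (∀ t ∈ Icc 0 s, HasDerivAt w (V p.1 (ξ t) t (w t)) t) →
      ∀ t ∈ Icc 0 s, ‖w t‖ ≤ M ∧ (t = T → ‖w t‖ ≤ c + 1)) ?_ ?_ ?_ ?_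
  · exact ⟨1, one_pos, 0, by simp⟩
  · rintro S S' hSS' ⟨ρ, hρ, M, hM⟩
    exact ⟨ρ, hρ, M, fun p hp => hM p (hSS' hp)⟩
  · rintro S S' ⟨ρ, hρ, M, hM⟩ ⟨ρ', hρ', M', hM'⟩
    refine ⟨min ρ ρ', lt_min hρ hρ', max M M', ?_⟩
    rintro p (hp | hp) s hs ξ w hξ hw0 hw t ht
    · obtain ⟨h1, h2⟩ := hM p hp s hs ξ w
        (fun t ht => (hξ t ht).trans_le (min_le_left _ _)) hw0 hw t ht
      exact ⟨h1.trans (le_max_left _ _), h2⟩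
    · obtain ⟨h1, h2⟩ := hM' p hp s hs ξ w
        (fun t ht => (hξ t ht).trans_le (min_le_right _ _)) hw0 hw t ht
      exact ⟨h1.trans (le_max_right _ _), h2⟩
  · intro p hp
    obtain ⟨ρ, hρ, M, hM⟩ := key p hp
    exact ⟨ball p ρ, mem_nhdsWithin_of_mem_nhds (ball_mem_nhds _ hρ), ρ, hρ, M,
      fun q hq => hM q hq⟩

/-- Forward uniqueness for locally Lipschitz fields. -/
theorem eq_of_forward_solutions {Y : Type*} [NormedAddCommGroup Y] [NormedSpace ℝ Y]
    {F : ℝ → Y → Y} (hL : ∀ R, ∃ L : ℝ≥0, ∀ t, LipschitzOnWith L (F t) (closedBall 0 R))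
    {u w : ℝ → Y} (hu : ∀ t ≥ 0, HasDerivAt u (F t (u t)) t)
    (hw : ∀ t ≥ 0, HasDerivAt w (F t (w t)) t) (h0 : u 0 = w 0) {t : ℝ} (ht : 0 ≤ t) :
    u t = w t := by
  have hcu : ContinuousOn u (Icc 0 t) := fun r hr => (hu r hr.1).continuousAt.continuousWithinAt
  have hcw : ContinuousOn w (Icc 0 t) := fun r hr => (hw r hr.1).continuousAt.continuousWithinAt
  obtain ⟨R, hR⟩ := isCompact_Icc.exists_bound_of_continuousOn hcu
  obtain ⟨R', hR'⟩ := isCompact_Icc.exists_bound_of_continuousOn hcw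
  obtain ⟨L, hLip⟩ := hL (max R R')
  exact ODE_solution_unique_of_mem_Icc_right (v := F) (s := fun _ => closedBall 0 (max R R'))
    (fun r _ => hLip r) hcu (fun r hr => (hu r hr.1).hasDerivWithinAt)
    (fun r hr => by simpa using Or.inl (hR r (Ico_subset_Icc_self hr))) hcw
    (fun r hr => (hw r hr.1).hasDerivWithinAt)
    (fun r hr => by simpa using Or.inr (hR' r (Ico_subset_Icc_self hr))) h0 ⟨ht, le_rfl⟩

/-- Solutions started at times `-N` that match up with each other glue to an entire solution. -/
theorem exists_entire_solution {Y : Type*} [NormedAddCommGroup Y] [NormedSpace ℝ Y]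
    {F : ℝ → Y → Y} (hL : ∀ R, ∃ L : ℝ≥0, ∀ t, LipschitzOnWith L (F t) (closedBall 0 R))
    {u : ℕ → ℝ → Y} (hu : ∀ N, ∀ t ≥ 0, HasDerivAt (u N) (F (t - N) (u N t)) t)
    (hmatch : ∀ N, u (N + 1) 1 = u N 0) :
    ∃ y : ℝ → Y, (∀ (N : ℕ) (τ : ℝ), -N ≤ τ → y τ = u N (τ + N)) ∧
      ∀ τ, HasDerivAt y (F τ (y τ)) τ := by
  have hstep : ∀ N, ∀ t ≥ 0, u (N + 1) (1 + t) = u N t := by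
    intro N t ht
    refine eq_of_forward_solutions (F := fun t => F (t - N)) (u := fun t => u (N + 1) (1 + t))
      (fun R => ?_) (fun r hr => ?_) (hu N) (by simpa using hmatch N) ht
    · obtain ⟨L, h⟩ := hL R
      exact ⟨L, fun t => h _⟩
    · have := (hu (N + 1) (1 + r) (by linarith)).comp_const_add
      convert! this using 2
      push_cast
      ring
  have hmany : ∀ (N j : ℕ) (t : ℝ), 0 ≤ t → u (N + j) (t + j) = u N t := by
    intro N j
    induction j with
    | zero => simp
    | succ j ih =>
      intro t ht
      rw [← ih t ht, ← hstep (N + j) (t + j) (by positivity)]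
      push_cast
      congr 1
      ring
  let y : ℝ → Y := fun τ => u ⌈|τ|⌉₊ (τ + ⌈|τ|⌉₊)
  have hy : ∀ (N : ℕ) (τ : ℝ), -N ≤ τ → y τ = u N (τ + N) := by
    intro N τ hN
    have hceil : 0 ≤ τ + ⌈|τ|⌉₊ := by linarith [Nat.le_ceil |τ|, neg_abs_le τ]
    rw [← hmany N ⌈|τ|⌉₊ _ (by linarith : 0 ≤ τ + N)]
    show u ⌈|τ|⌉₊ (τ + ⌈|τ|⌉₊) = _
    rw [← hmany ⌈|τ|⌉₊ N _ hceil, add_comm N, add_right_comm]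
  refine ⟨y, hy, fun τ => ?_⟩
  obtain ⟨N, hN⟩ := exists_nat_gt (-τ)
  have hev : y =ᶠ[𝓝 τ] fun r => u N (r + N) := by
    filter_upwards [lt_mem_nhds (neg_lt.1 hN)] with r hr
    exact hy N r hr.le
  rw [hy N τ (by linarith)]
  have := (hu N (τ + N) (by linarith)).comp_add_const
  rw [add_sub_cancel_right] at this
  exact this.congr_of_eventuallyEq hev

end ParametrizedField

/-- A point of the closure of the forward orbit lies on the orbit or in the omega-limit set. -/
theorem mem_orbit_or_mem_omegaSet {H : Type*} [TopologicalSpace H] [T2Space H] {σf : ℝ → H → H}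
    (hσ : Continuous fun p : ℝ × H => σf p.1 p.2) {g0 h : H}
    (hh : h ∈ closure {h : H | ∃ τ ≥ (0 : ℝ), h = σf τ g0}) :
    (∃ s ≥ (0 : ℝ), h = σf s g0) ∨ h ∈ omegaSet σf g0 := by
  by_contra! hcon
  obtain ⟨horbit, homega⟩ := hcon
  simp only [omegaSet, mem_iInter, not_forall] at homega
  obtain ⟨s, -, hsh⟩ := homega
  have hcont : Continuous fun τ : ℝ => σf τ g0 := hσ.comp (continuous_id.prodMk continuous_const)
  have hsub : {h : H | ∃ τ ≥ (0 : ℝ), h = σf τ g0} ⊆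
      (fun τ => σf τ g0) '' Icc 0 s ∪ {h : H | ∃ τ ≥ s, h = σf τ g0} := by
    rintro _ ⟨τ, hτ, rfl⟩
    rcases le_total τ s with hle | hle
    · exact Or.inl ⟨τ, ⟨hτ, hle⟩, rfl⟩
    · exact Or.inr ⟨τ, hle, rfl⟩
  have := closure_mono hsub hh
  rw [closure_union, (isCompact_Icc.image hcont).isClosed.closure_eq] at this
  rcases this with ⟨τ, hτ, rfl⟩ | h'
  · exact horbit τ hτ.1 rfl
  · exact hsh h'

/-- The omega-limit set is invariant under the flow. -/
theorem flow_mem_omegaSet {H : Type*} [TopologicalSpace H] {σf : ℝ → H → H}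
    (hσ : Continuous fun p : ℝ × H => σf p.1 p.2)
    (hσadd : ∀ s t : ℝ, ∀ h, σf (s + t) h = σf s (σf t h)) {g0 h : H}
    (hh : h ∈ omegaSet σf g0) (r : ℝ) : σf r h ∈ omegaSet σf g0 := by
  simp only [omegaSet, mem_iInter, mem_Ici] at hh ⊢
  intro s hs
  have hcont : Continuous (σf r) := hσ.comp (continuous_const.prodMk continuous_id)
  refine map_mem_closure hcont (hh (max 0 (s - r)) (le_max_left _ _)) ?_
  rintro _ ⟨τ, hτ, rfl⟩
  exact ⟨r + τ, by linarith [le_max_right 0 (s - r)], (hσadd r τ g0).symm⟩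

/-- Limits along the orbit at times tending to infinity lie in the omega-limit set. -/
theorem mem_omegaSet_of_tendsto {H ι : Type*} [TopologicalSpace H] {σf : ℝ → H → H} {g0 h : H}
    {l : Filter ι} [l.NeBot] {τ : ι → ℝ} (hτ : Tendsto τ l atTop)
    (hlim : Tendsto (fun i => σf (τ i) g0) l (𝓝 h)) : h ∈ omegaSet σf g0 := by
  simp only [omegaSet, mem_iInter, mem_Ici]
  intro s _
  exact mem_closure_of_tendsto hlim
    ((hτ.eventually_ge_atTop s).mono fun i hi => ⟨τ i, hi, rfl⟩)

open scoped NNReal in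
/-- Every element of the hull inherits the Lipschitz bound of `g` in `y`. -/
theorem IsLipschitzInY.lipschitzOnWith_of_mem_closure {n m : ℕ}
    {g : C(EuclideanSpace ℝ (Fin n) × EuclideanSpace ℝ (Fin m) × ℝ, EuclideanSpace ℝ (Fin m))}
    (hlip : IsLipschitzInY g) (x : EuclideanSpace ℝ (Fin n)) (R : ℝ) :
    ∃ L : ℝ≥0, ∀ φ ∈ closure {φ | ∃ s : ℝ, φ = timeTranslate s g}, ∀ t : ℝ,
      LipschitzOnWith L (fun y => φ (x, y, t)) (closedBall 0 R) := by
  obtain ⟨L, hL, h⟩ := hlip {x} isCompact_singleton (closedBall 0 R) (isCompact_closedBall _ _)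
  refine ⟨⟨L, hL.le⟩, fun φ hφ t => LipschitzOnWith.of_dist_le_mul fun y₁ hy₁ y₂ hy₂ => ?_⟩
  have hclosed : IsClosed {φ : C(EuclideanSpace ℝ (Fin n) × EuclideanSpace ℝ (Fin m) × ℝ,
      EuclideanSpace ℝ (Fin m)) | dist (φ (x, y₁, t)) (φ (x, y₂, t)) ≤ L * dist y₁ y₂} :=
    isClosed_le (by fun_prop) (by fun_prop)
  refine closure_minimal ?_ hclosed hφ
  rintro _ ⟨s, rfl⟩
  rw [mem_ofPred_eq, dist_eq_norm, dist_eq_norm]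
  exact h x rfl y₁ hy₁ y₂ hy₂ (t + s)

/-- under the relaxed assumptions, if g·(t₀/ε_k) → h₀ then h₀ ∈ O(g) and the fast final values approach A_{(h₀,x₀(t₀))}. -/
theorem stmt_19
    {n m : ℕ} (hn : 1 ≤ n) (hm : 1 ≤ m)
    -- g, admissible and Lipschitz in y on compacts
    (g : C(EuclideanSpace ℝ (Fin n) × EuclideanSpace ℝ (Fin m) × ℝ,
      EuclideanSpace ℝ (Fin m)))
    (hadm : IsAdmissibleMap g) (hlip : IsLipschitzInY g)
    -- the hull H of g, a compact metric space with the continuous shift flow,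
    -- identified via the embedding ev with the closure of the translates of g
    (H : Type) [MetricSpace H] [CompactSpace H]
    (σf : ℝ → H → H)
    (hσcont : Continuous fun p : ℝ × H => σf p.1 p.2)
    (hσ0 : ∀ h, σf 0 h = h)
    (hσadd : ∀ s t : ℝ, ∀ h, σf (s + t) h = σf s (σf t h))
    (ev : H → C(EuclideanSpace ℝ (Fin n) × EuclideanSpace ℝ (Fin m) × ℝ,
      EuclideanSpace ℝ (Fin m)))
    (hev : Topology.IsEmbedding ev)
    (hrange : Set.range ev = closure {h | ∃ s : ℝ, h = timeTranslate s g})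
    (g0 : H) (hg0 : ev g0 = g)
    (hequiv : ∀ (s : ℝ) (h : H), ev (σf s h) = timeTranslate s (ev h))
    -- the (unique, maximal) solutions y(τ,h,x,τ₀,y₀) of y' = h(x,y,τ)
    (sol : H → EuclideanSpace ℝ (Fin n) → ℝ → EuclideanSpace ℝ (Fin m) → ℝ →
      EuclideanSpace ℝ (Fin m))
    (hsolinit : ∀ h x τ₀ y₀, sol h x τ₀ y₀ τ₀ = y₀)
    -- (H1'): solutions over the forward orbit of g and over O(g) are globally
    -- defined in the future
    (hsolodeO : ∀ h ∈ omegaSet σf g0, ∀ x (τ₀ : ℝ) y₀ (τ : ℝ), τ₀ ≤ τ →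
      HasDerivAt (sol h x τ₀ y₀) (ev h (x, sol h x τ₀ y₀ τ, τ)) τ)
    (hsolodeG : ∀ s : ℝ, 0 ≤ s → ∀ x (τ₀ : ℝ) y₀ (τ : ℝ), 0 ≤ τ₀ → τ₀ ≤ τ →
      HasDerivAt (sol (σf s g0) x τ₀ y₀) (ev (σf s g0) (x, sol (σf s g0) x τ₀ y₀ τ, τ)) τ)
    -- (H2'): uniform ultimate boundedness on [0,∞) over compact sets of parameters
    (hH2' : ∀ K₀ : Set (EuclideanSpace ℝ (Fin n)), IsCompact K₀ →
      ∃ c > (0:ℝ), ∀ d > (0:ℝ), ∃ T > (0:ℝ), ∀ x ∈ K₀, ∀ τ₀ : ℝ, 0 ≤ τ₀ → ∀ τ ≥ T,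
        ∀ y₀ : EuclideanSpace ℝ (Fin m), ‖y₀‖ ≤ d → ‖sol g0 x τ₀ y₀ (τ + τ₀)‖ ≤ c)
    -- the slow vector field f, continuous and of linear growth
    (f : EuclideanSpace ℝ (Fin n) → EuclideanSpace ℝ (Fin m) → EuclideanSpace ℝ (Fin n))
    (hf : Continuous fun p : EuclideanSpace ℝ (Fin n) × EuclideanSpace ℝ (Fin m) =>
      f p.1 p.2)
    (a b : ℝ) (ha : 0 < a) (hb : 0 < b)
    (hgrowth : ∀ x y, ‖f x y‖ ≤ a + b * ‖x‖)
    -- initial data, final slow time, the sequence ε_k ↓ 0, and the solutions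
    -- (x_{ε_k}, y_{ε_k}) of the slow-fast system in the fast time
    (xInit : EuclideanSpace ℝ (Fin n)) (yInit : EuclideanSpace ℝ (Fin m))
    (t₀ : ℝ) (ht₀ : 0 < t₀)
    (ε : ℕ → ℝ) (hεpos : ∀ k, 0 < ε k) (hεanti : StrictAnti ε)
    (hεlim : Tendsto ε atTop (𝓝 0))
    (xe : ℕ → ℝ → EuclideanSpace ℝ (Fin n)) (ye : ℕ → ℝ → EuclideanSpace ℝ (Fin m))
    (hxe0 : ∀ k, xe k 0 = xInit) (hye0 : ∀ k, ye k 0 = yInit)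
    (hxeode : ∀ k : ℕ, ∀ τ ∈ Set.Icc (0:ℝ) (t₀ / ε k),
      HasDerivAt (xe k) (ε k • f (xe k τ) (ye k τ)) τ)
    (hyeode : ∀ k : ℕ, ∀ τ ∈ Set.Icc (0:ℝ) (t₀ / ε k),
      HasDerivAt (ye k) (g (xe k τ, ye k τ, τ)) τ)
    -- the slow components converge uniformly (in the slow time) to x₀
    (x0 : ℝ → EuclideanSpace ℝ (Fin n)) (hx0cont : ContinuousOn x0 (Set.Icc 0 t₀))
    (hconv : TendstoUniformlyOn (fun k t => xe k (t / ε k)) x0 atTop (Set.Icc 0 t₀))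
    -- the radius of the compact tube K₀ around x₀
    (r : ℝ) (hr : 0 < r)
    (h₀ : H) (hlim : Tendsto (fun k : ℕ => σf (t₀ / ε k) g0) atTop (𝓝 h₀)) :
    h₀ ∈ omegaSet σf g0 ∧
      Tendsto (fun k : ℕ => Metric.infDist (ye k (t₀ / ε k)) (attrFiber ev h₀ (x0 t₀)))
        atTop (𝓝 0) := by
  have htime : Tendsto (fun k => t₀ / ε k) atTop atTop := by
    have : Tendsto ε atTop (𝓝[>] 0) :=
      tendsto_nhdsWithin_iff.2 ⟨hεlim, Eventually.of_forall hεpos⟩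
    simpa [div_eq_mul_inv] using (tendsto_inv_nhdsGT_zero.comp this).const_mul_atTop ht₀
  have hh₀ : h₀ ∈ omegaSet σf g0 := mem_omegaSet_of_tendsto htime hlim
  refine ⟨hh₀, ?_⟩
  set V : H → EuclideanSpace ℝ (Fin n) → ℝ → EuclideanSpace ℝ (Fin m) →
    EuclideanSpace ℝ (Fin m) := fun h x t y => ev h (x, y, t) with hVdef
  have hV : Continuous fun p : (H × EuclideanSpace ℝ (Fin n)) × (ℝ × EuclideanSpace ℝ (Fin m)) =>
      V p.1.1 p.1.2 p.2.1 p.2.2 := by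
    have := hev.continuous
    simp only [hVdef]
    fun_prop
  have hL : ∀ h x R, ∃ L : NNReal, ∀ t, LipschitzOnWith L (V h x t) (closedBall 0 R) := by
    intro h x R
    obtain ⟨L, hL⟩ := hlip.lipschitzOnWith_of_mem_closure x R
    exact ⟨L, hL (ev h) (hrange ▸ mem_range_self h)⟩
  have hVshift : ∀ s h x t y, V (σf s h) x t y = V h x (t + s) y := by
    intro s h x t y
    simp only [hVdef, hequiv]
    rfl
  have hVg : ∀ s x t y, V (σf s g0) x t y = g (x, y, t + s) := by
    intro s x t y
    rw [hVshift, hVdef, ← hg0]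
  set P := closure {h : H | ∃ τ ≥ (0 : ℝ), h = σf τ g0} with hP
  have hPorbit : ∀ τ ≥ (0 : ℝ), σf τ g0 ∈ P := fun τ hτ => subset_closure ⟨τ, hτ, rfl⟩
  have hPomega : omegaSet σf g0 ⊆ P := fun h hh => by
    simp only [omegaSet, mem_iInter, mem_Ici] at hh
    exact hh 0 le_rfl
  have hsol : ∀ h ∈ P, ∀ x y, ∃ u : ℝ → EuclideanSpace ℝ (Fin m), u 0 = y ∧
      ∀ t ≥ 0, HasDerivAt u (V h x t (u t)) t := by
    intro h hh x y
    refine ⟨sol h x 0 y, hsolinit _ _ _ _, fun t ht => ?_⟩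
    rcases mem_orbit_or_mem_omegaSet hσcont hh with ⟨s, hs, rfl⟩ | hO
    · exact hsolodeG s hs x 0 y t le_rfl ht
    · exact hsolodeO h hO x 0 y t ht
  set K₀ := cthickening 1 (x0 '' Icc 0 t₀) with hK₀
  have hK₀c : IsCompact K₀ := (isCompact_Icc.image_of_continuousOn hx0cont).cthickening
  obtain ⟨c, hc, hbound⟩ := hH2' K₀ hK₀c
  have hdiss : ∀ d > 0, ∃ T > 0, ∀ h ∈ P, ∀ x ∈ K₀, ∀ u : ℝ → EuclideanSpace ℝ (Fin m),
      ‖u 0‖ ≤ d → (∀ t ≥ 0, HasDerivAt u (V h x t (u t)) t) → ∀ t ≥ T, ‖u t‖ ≤ c := by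
    intro d hd
    obtain ⟨T, hT, hbd⟩ := hbound d hd
    refine ⟨T, hT, fun h hh x hx u hu0 hu t ht => le_of_forall_pos_le_add fun η hη => ?_⟩
    obtain ⟨ρ, hρ, hnear⟩ := exists_radius_dist_lt hV hL (T := t) hη (fun r hr => hu r hr.1)
    obtain ⟨_, ⟨τ, hτ, rfl⟩, hdist⟩ := Metric.mem_closure_iff.1 hh ρ hρ
    have hd := hnear (σf τ g0) (by rwa [dist_comm]) t le_rfl (fun _ => x)
      (fun r => sol g0 x τ (u 0) (r + τ)) (fun _ _ => by simpa using hρ)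
      (fun r hr => by
        have := hsolodeG 0 le_rfl x τ (u 0) (r + τ) hτ (by linarith [hr.1])
        rw [hσ0] at this
        rw [hVshift]
        exact this.comp_add_const)
      (by simpa [hsolinit] using hρ) t ⟨hT.le.trans ht, le_rfl⟩
    have h1 := hbd x hx τ hτ t ht (u 0) hu0
    have h2 := norm_le_norm_add_norm_sub (sol g0 x τ (u 0) (t + τ)) (u t)
    rw [dist_eq_norm] at hd
    linarith
  have hslow : ∀ {k τ}, τ ∈ Icc 0 (t₀ / ε k) → ε k * τ ∈ Icc 0 t₀ ∧ ε k * τ / ε k = τ := by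
    intro k τ hτ
    have := hεpos k
    refine ⟨⟨mul_nonneg this.le hτ.1, ?_⟩, by field_simp⟩
    have h := (le_div_iff₀ this).1 hτ.2
    linarith
  have hxclose : ∀ ρ > 0, ∀ᶠ k in atTop, ∀ τ ∈ Icc 0 (t₀ / ε k),
      dist (xe k τ) (x0 (ε k * τ)) < ρ := by
    intro ρ hρ
    filter_upwards [Metric.tendstoUniformlyOn_iff.1 hconv ρ hρ] with k hk τ hτ
    have := hk _ (hslow hτ).1
    rwa [(hslow hτ).2, dist_comm] at this
  have hxmem : ∀ᶠ k in atTop, ∀ τ ∈ Icc 0 (t₀ / ε k), xe k τ ∈ K₀ := by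
    filter_upwards [hxclose 1 one_pos] with k hk τ hτ
    exact mem_cthickening_of_dist_le _ _ _ _ (mem_image_of_mem _ (hslow hτ).1) (hk τ hτ).le
  have hxslow : ∀ ρ > 0, ∀ T, ∀ᶠ k in atTop, ∀ τ ∈ Icc 0 (t₀ / ε k), ∀ τ' ∈ Icc 0 (t₀ / ε k),
      |τ - τ'| ≤ T → dist (xe k τ) (xe k τ') < ρ := by
    intro ρ hρ T
    obtain ⟨δ, hδ, hunif⟩ := Metric.uniformContinuousOn_iff.1
      (isCompact_Icc.uniformContinuousOn_of_continuous hx0cont) (ρ / 3) (by positivity)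
    have hεT : Tendsto (fun k => ε k * T) atTop (𝓝 0) := by simpa using hεlim.mul_const T
    filter_upwards [hxclose (ρ / 3) (by positivity), hεT.eventually_lt_const hδ]
      with k hk hkT τ hτ τ' hτ' hττ'
    have h1 := hunif _ (hslow hτ).1 _ (hslow hτ').1 (by
      rw [Real.dist_eq, ← mul_sub, abs_mul, abs_of_pos (hεpos k)]
      exact (mul_le_mul_of_nonneg_left hττ' (hεpos k).le).trans_lt hkT)
    have h2 := dist_triangle4 (xe k τ) (x0 (ε k * τ)) (x0 (ε k * τ')) (xe k τ')
    linarith [hk τ hτ, dist_comm (xe k τ') (x0 (ε k * τ')), hk τ' hτ']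
  have hyshift : ∀ k a, 0 ≤ a → ∀ s, a + s ≤ t₀ / ε k → ∀ t ∈ Icc 0 s,
      HasDerivAt (fun t => ye k (a + t)) (V (σf a g0) (xe k (a + t)) t (ye k (a + t))) t := by
    intro k a ha s hs t ht
    rw [hVg, add_comm t a]
    exact (hyeode k (a + t) ⟨by linarith [ht.1], by linarith [ht.2]⟩).comp_const_add
  have hybound : ∃ M, ∀ᶠ k in atTop, ∀ τ ∈ Icc 0 (t₀ / ε k), ‖ye k τ‖ ≤ M := by
    set d := max (c + 1) ‖yInit‖ with hd
    have hdpos : 0 < d := lt_max_of_lt_left (by linarith)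
    obtain ⟨T, hT, hTc⟩ := hdiss d hdpos
    have hcomp : IsCompact (P ×ˢ K₀ ×ˢ closedBall (0 : EuclideanSpace ℝ (Fin m)) d) :=
      isClosed_closure.isCompact.prod (hK₀c.prod (isCompact_closedBall _ _))
    obtain ⟨ρ, hρ, M, hM⟩ := exists_uniform_bound hV hL hcomp (T := T) (c := c) (by
      rintro ⟨h, x, y⟩ ⟨hh, hx, hy⟩
      obtain ⟨u, hu0, hu⟩ := hsol h hh x y
      exact ⟨u, hu0, fun t ht => hu t ht.1,
        hTc h hh x hx u (by simpa [hu0] using hy) hu T le_rfl⟩)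
    refine ⟨M, ?_⟩
    filter_upwards [hxmem, hxslow ρ hρ T] with k hkmem hkslow
    have hstep : ∀ a ≥ 0, ‖ye k a‖ ≤ d → ∀ s ≤ T, a + s ≤ t₀ / ε k → ∀ t ∈ Icc 0 s,
        ‖ye k (a + t)‖ ≤ M ∧ (t = T → ‖ye k (a + t)‖ ≤ c + 1) := by
      intro a ha had s hsT hs t ht
      have hs0 := ht.1.trans ht.2
      have haI : a ∈ Icc 0 (t₀ / ε k) := ⟨ha, by linarith⟩
      refine hM (σf a g0, xe k a, ye k a) ⟨hPorbit a ha, hkmem a haI, by simpa using had⟩ s hsT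
        (fun t => xe k (a + t)) (fun t => ye k (a + t)) (fun r hr => ?_) (by simp)
        (hyshift k a ha s hs) t ht
      refine hkslow _ ⟨by linarith [hr.1], by linarith [hr.2]⟩ _ haI ?_
      rw [add_sub_cancel_left, abs_of_nonneg hr.1]
      exact hr.2.trans hsT
    have hgrid : ∀ j : ℕ, j * T ≤ t₀ / ε k → ‖ye k (j * T)‖ ≤ d := by
      intro j
      induction j with
      | zero => simp [hye0, hd]
      | succ j ih =>
        intro hj
        push_cast at hj ⊢
        rw [add_mul, one_mul] at hj ⊢
        exact ((hstep (j * T) (by positivity) (ih (by linarith)) T le_rfl hj T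
          ⟨hT.le, le_rfl⟩).2 rfl).trans (le_max_left _ _)
    intro τ hτ
    have h1 : ⌊τ / T⌋₊ * T ≤ τ := (le_div_iff₀ hT).1 (Nat.floor_le (div_nonneg hτ.1 hT.le))
    have h2 : τ < ⌊τ / T⌋₊ * T + T := by
      have := (div_lt_iff₀ hT).1 (Nat.lt_floor_add_one (τ / T))
      linarith
    have := (hstep (⌊τ / T⌋₊ * T) (by positivity) (hgrid _ (h1.trans hτ.2)) (τ - ⌊τ / T⌋₊ * T)
      (by linarith) (by linarith [hτ.2]) (τ - ⌊τ / T⌋₊ * T) ⟨by linarith, le_rfl⟩).1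
    rwa [add_sub_cancel] at this
  obtain ⟨M, hM⟩ := hybound
  have hx0mem : x0 t₀ ∈ K₀ :=
    self_subset_cthickening _ (mem_image_of_mem _ ⟨ht₀.le, le_rfl⟩)
  have hxend : ∀ ρ > 0, ∀ T, ∀ᶠ k in atTop, ∀ τ ∈ Icc 0 (t₀ / ε k), t₀ / ε k - τ ≤ T →
      dist (xe k τ) (x0 t₀) < ρ := by
    intro ρ hρ T
    filter_upwards [hxclose (ρ / 2) (half_pos hρ), hxslow (ρ / 2) (half_pos hρ) T]
      with k h1 h2 τ hτ hτT
    have hend : t₀ / ε k ∈ Icc 0 (t₀ / ε k) := ⟨div_nonneg ht₀.le (hεpos k).le, le_rfl⟩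
    have h3 := h1 _ hend
    rw [mul_div_cancel₀ _ (hεpos k).ne'] at h3
    have h4 := h2 τ hτ _ hend (by rw [abs_sub_comm, abs_of_nonneg (by linarith [hτ.2])]; exact hτT)
    linarith [dist_triangle (xe k τ) (xe k (t₀ / ε k)) (x0 t₀)]
  refine tendsto_of_subseq_tendsto fun ns hns => ?_
  obtain ⟨k₀, hk₀⟩ := (hns.eventually hM).exists_forall_of_atTop
  have hcomp : IsCompact (Set.pi univ fun _ : ℕ => closedBall (0 : EuclideanSpace ℝ (Fin m)) M) :=
    isCompact_univ_pi fun _ => isCompact_closedBall _ _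
  obtain ⟨z, -, φ, hφ, hz⟩ := hcomp.tendsto_subseq
    (x := fun (j N : ℕ) => ye (ns (k₀ + j)) (max 0 (t₀ / ε (ns (k₀ + j)) - N))) (by
      intro j N _
      simpa using hk₀ _ (Nat.le_add_right k₀ j) _
        ⟨le_max_left _ _, max_le (div_nonneg ht₀.le (hεpos _).le) (by simp)⟩)
  set κ : ℕ → ℕ := fun j => ns (k₀ + φ j) with hκ
  have hκlim : Tendsto κ atTop atTop :=
    hns.comp (tendsto_atTop_mono (fun j => Nat.le_add_left _ _) hφ.tendsto_atTop)
  have hendtime : Tendsto (fun j => t₀ / ε (κ j)) atTop atTop := htime.comp hκlim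
  have hzN : ∀ N : ℕ, Tendsto (fun j => ye (κ j) (t₀ / ε (κ j) - N)) atTop (𝓝 (z N)) := by
    intro N
    refine (tendsto_pi_nhds.1 hz N).congr' ?_
    filter_upwards [hendtime.eventually_ge_atTop (N : ℝ)] with j hj
    simp only [Function.comp_apply]
    rw [max_eq_right (by simpa [hκ] using hj)]
  have hzM : ∀ N, ‖z N‖ ≤ M := by
    intro N
    refine le_of_tendsto (hzN N).norm ?_
    filter_upwards [hκlim.eventually hM, hendtime.eventually_ge_atTop (N : ℝ)] with j h1 h2
    exact h1 _ ⟨by linarith, by simp⟩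
  have hback : ∀ N : ℕ, σf (-N) h₀ ∈ omegaSet σf g0 := fun N =>
    flow_mem_omegaSet hσcont hσadd hh₀ _
  choose u hu0 hu using fun N : ℕ => hsol _ (hPomega (hback N)) (x0 t₀) (z N)
  have hmatch : ∀ N, u (N + 1) 1 = u N 0 := by
    intro N
    refine tendsto_nhds_unique ?_ ((hzN N).trans_eq (by rw [hu0]))
    rw [Metric.tendsto_nhds]
    intro η hη
    obtain ⟨ρ, hρ, hnear⟩ := exists_radius_dist_lt hV hL (T := 1) hη (fun r hr => hu (N + 1) r hr.1)
    have hbase : Tendsto (fun j => σf (t₀ / ε (κ j) - (N + 1 : ℕ)) g0) atTop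
        (𝓝 (σf (-(N + 1 : ℕ)) h₀)) := by
      have hcont : Continuous (σf (-((N + 1 : ℕ) : ℝ))) :=
        hσcont.comp (continuous_const.prodMk continuous_id)
      refine ((hcont.tendsto h₀).comp (hlim.comp hκlim)).congr fun j => ?_
      simp only [Function.comp_apply]
      rw [← hσadd, neg_add_eq_sub]
    filter_upwards [Metric.tendsto_nhds.1 hbase ρ hρ, Metric.tendsto_nhds.1 (hzN (N + 1)) ρ hρ,
      hκlim.eventually (hxend ρ hρ (N + 1)), hendtime.eventually_ge_atTop ((N + 1 : ℕ) : ℝ)]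
      with j h1 h2 h3 h4
    have h5 := hnear _ h1 1 le_rfl (fun t => xe (κ j) (t₀ / ε (κ j) - (N + 1 : ℕ) + t))
      (fun t => ye (κ j) (t₀ / ε (κ j) - (N + 1 : ℕ) + t))
      (fun t ht => by
        have hN : (0 : ℝ) ≤ N := N.cast_nonneg
        push_cast at h4 ⊢
        exact h3 _ ⟨by linarith [ht.1], by linarith [ht.2]⟩ (by linarith [ht.1]))
      (hyshift _ _ (by linarith) 1 (by push_cast; linarith [N.cast_nonneg (α := ℝ)]))
      (by simpa [hu0] using h2) 1 ⟨zero_le_one, le_rfl⟩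
    convert! h5 using 3
    push_cast
    ring
  obtain ⟨y, hyu, hyode⟩ := exists_entire_solution (F := V h₀ (x0 t₀)) (hL _ _)
    (fun N t ht => by simpa [hVshift, ← sub_eq_add_neg] using hu N t ht) hmatch
  have hmem : z 0 ∈ attrFiber ev h₀ (x0 t₀) := by
    refine ⟨y, ?_, ⟨c, fun τ => ?_⟩, hyode⟩
    · simpa [hu0] using hyu 0 0 (by simp)
    · obtain ⟨T, hT, hTc⟩ := hdiss (max M 1) (by positivity)
      obtain ⟨N, hN⟩ := exists_nat_ge (T - τ)
      rw [hyu N τ (by linarith)]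
      exact hTc _ (hPomega (hback N)) _ hx0mem (u N)
        (by rw [hu0]; exact (hzM N).trans (le_max_left _ _)) (hu N) _ (by linarith)
  refine ⟨fun j => k₀ + φ j, squeeze_zero (fun _ => infDist_nonneg)
    (fun j => infDist_le_dist_of_mem hmem) ?_⟩
  simpa using tendsto_iff_dist_tendsto_zero.1 (hzN 0)
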